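/- Let $1 < p < \infty$, $0 < s < 1$ with $sp < 1$. Then for all $f \in W^{s,p}(T)$ on the reference triangle $T$, $\int_T \mathrm{dist}(\mathbf{x}, \partial T)^{-sp} |f(\mathbf{x})|^p\,d\mathbf{x} \lesssim_{s,p} \|f\|_{W^{s,p}(T)}^p$ (no boundary condition on $f$ is required). -/

import Mathlib

open MeasureTheory Set

/-- The open reference triangle as a subset of the Euclidean plane. -/
def refTriE : Set (EuclideanSpace ℝ (Fin 2)) :=
  {x | 0 < x 0 ∧ 0 < x 1 ∧ x 0 + x 1 < 1}

abbrev EE := EuclideanSpace ℝ (Fin 2)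

lemma lintegral_affine (A : EE →ₗ[ℝ] EE) (hA : LinearMap.det A ≠ 0) (b : EE)
    (g : EE → ENNReal) (hg : Measurable g) :
    ∫⁻ x, g (A x + b) = ENNReal.ofReal |(LinearMap.det A)⁻¹| * ∫⁻ y, g y := by
  have hAm : Measurable A := (LinearMap.continuous_of_finiteDimensional A).measurable
  have h1 : ∫⁻ x, g (A x + b) = ∫⁻ y, g (y + b) ∂(Measure.map A volume) := by
    rw [lintegral_map (by fun_prop) hAm]
  rw [h1, Measure.map_linearMap_addHaar_eq_smul_addHaar volume hA, lintegral_smul_measure,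
    lintegral_add_right_eq_self g b, smul_eq_mul]

lemma pow_ineq (p : ℝ) (hp : 1 < p) (a b : ℝ) :
    |a| ^ p ≤ 2 ^ p * (|a - b| ^ p + |b| ^ p) := by
  have h : |a| ≤ |a - b| + |b| := by
    have := abs_add_le (a - b) b
    simpa using this
  have h0 : (0:ℝ) ≤ |a - b| ^ p := by positivity
  have h0' : (0:ℝ) ≤ |b| ^ p := by positivity
  rcases le_total |a - b| |b| with h1 | h1
  · calc |a| ^ p ≤ (2 * |b|) ^ p := by
          apply Real.rpow_le_rpow (abs_nonneg _) (by linarith) (by linarith)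
      _ = 2 ^ p * |b| ^ p := Real.mul_rpow (by norm_num) (abs_nonneg _)
      _ ≤ _ := by gcongr; linarith
  · calc |a| ^ p ≤ (2 * |a - b|) ^ p := by
          apply Real.rpow_le_rpow (abs_nonneg _) (by linarith) (by linarith)
      _ = 2 ^ p * |a - b| ^ p := Real.mul_rpow (by norm_num) (abs_nonneg _)
      _ ≤ _ := by gcongr; linarith

/-- The Gagliardo kernel. -/
noncomputable def Qk (p σ : ℝ) (f : EE → ℝ) (x y : EE) : ENNReal :=
  ENNReal.ofReal (|f x - f y| ^ p / ‖x - y‖ ^ (σ + 2))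

lemma Qk_meas (p σ : ℝ) (f : EE → ℝ) (hf : Measurable f) :
    Measurable (fun z : EE × EE => Qk p σ f z.1 z.2) := by
  unfold Qk; fun_prop

/-- first term: inner integral in the displacement. -/
lemma first_term (p σ : ℝ) (hp : 1 < p) (hσ0 : 0 < σ) (T V : Set EE) (hT : MeasurableSet T)
    (hV : MeasurableSet V) (M : ℝ) (hM : 0 < M) (hVM : ∀ v ∈ V, ‖v‖ ≤ M)
    (f : EE → ℝ) (hf : Measurable f) (x : EE) (r : ℝ) (hr : 0 < r)
    (hx : ∀ v ∈ V, x + r • v ∈ T) :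
    ∫⁻ v in V, ENNReal.ofReal (r ^ (-σ) * |f x - f (x + r • v)| ^ p)
      ≤ ENNReal.ofReal (M ^ (σ + 2)) * ∫⁻ y in T, Qk p σ f x y := by
  have hQ : Measurable (fun y => Qk p σ f x y) := by
    unfold Qk; fun_prop
  have hdet : LinearMap.det (r • (LinearMap.id : EE →ₗ[ℝ] EE)) = r ^ 2 := by
    rw [LinearMap.det_smul]; simp
  have key := lintegral_affine (r • (LinearMap.id : EE →ₗ[ℝ] EE)) (by rw [hdet]; positivity) x
    (T.indicator (fun y => Qk p σ f x y)) (hQ.indicator hT)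
  rw [hdet, lintegral_indicator hT] at key
  have hk2 : ∫⁻ y in T, Qk p σ f x y = ENNReal.ofReal (r ^ 2) *
      ∫⁻ v, (T.indicator (fun y => Qk p σ f x y)) ((r • (LinearMap.id : EE →ₗ[ℝ] EE)) v + x) := by
    rw [key, ← mul_assoc, ← ENNReal.ofReal_mul (by positivity)]
    rw [abs_of_pos (by positivity), mul_inv_cancel₀ (by positivity)]; simp
  rw [hk2, ← lintegral_const_mul', ← lintegral_const_mul']
  rotate_left
  · simp
  · simp
  rw [← lintegral_indicator hV]
  apply lintegral_mono
  intro v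
  by_cases hv : v ∈ V
  · have hT' := hx v hv
    have e1 : (r • (LinearMap.id : EE →ₗ[ℝ] EE)) v + x = x + r • v := by
      simp [add_comm]
    simp only [indicator_of_mem hv, e1, indicator_of_mem hT', Qk]
    rw [← ENNReal.ofReal_mul (by positivity), ← ENNReal.ofReal_mul (by positivity)]
    apply ENNReal.ofReal_le_ofReal
    by_cases hv0 : v = 0
    · subst hv0
      simp [Real.zero_rpow (show p ≠ 0 by linarith)]
    have hvn : 0 < ‖v‖ := norm_pos_iff.mpr hv0
    have e2 : ‖x - (x + r • v)‖ = r * ‖v‖ := by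
      simp [norm_smul, abs_of_pos hr]
    rw [e2, Real.mul_rpow hr.le hvn.le]
    have e3 : r ^ (σ + 2) = r ^ σ * r ^ 2 := by
      rw [Real.rpow_add hr]; norm_cast
    have hle : ‖v‖ ^ (σ + 2) ≤ M ^ (σ + 2) :=
      Real.rpow_le_rpow hvn.le (hVM v hv) (by linarith)
    rw [e3, Real.rpow_neg hr.le]
    have h1 : 0 < r ^ σ := by positivity
    have h2 : 0 < ‖v‖ ^ (σ + 2) := by positivity
    have h3 : 0 ≤ |f x - f (x + r • v)| ^ p := by positivity
    generalize |f x - f (x + r • v)| ^ p = D at *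
    generalize ‖v‖ ^ (σ + 2) = a at *
    generalize M ^ (σ + 2) = m at *
    generalize r ^ σ = q at *
    have : m * (r ^ 2 * (D / (q * r ^ 2 * a))) = (q⁻¹ * D) * (m / a) := by
      field_simp
    rw [this]
    apply le_mul_of_one_le_right (by positivity)
    rwa [one_le_div h2]
  · simp [indicator_of_notMem hv]

/-- second term: for fixed displacement. -/
lemma second_term (p σ : ℝ) (T R : Set EE) (hT : MeasurableSet T) (hR : MeasurableSet R)
    (L : EE →L[ℝ] ℝ) (c : ℝ) (v : EE) (lam : ℝ) (hlam : 0 ≤ lam) (hLv : lam ≤ L v)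
    (hσ1 : σ < 1)
    (hRpos : ∀ x ∈ R, 0 < c + L x)
    (hx : ∀ x ∈ R, x + (c + L x) • v ∈ T)
    (f : EE → ℝ) (hf : Measurable f) :
    ∫⁻ x in R, ENNReal.ofReal ((c + L x) ^ (-σ) * |f (x + (c + L x) • v)| ^ p)
      ≤ ENNReal.ofReal ((1 + lam) ^ (σ - 1)) *
        ∫⁻ y in T, ENNReal.ofReal ((c + L y) ^ (-σ) * |f y| ^ p) := by
  set A : EE →ₗ[ℝ] EE := LinearMap.transvection (L : EE →ₗ[ℝ] ℝ) v with hAdef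
  have hdet : LinearMap.det A = 1 + L v := by
    rw [hAdef, LinearMap.transvection.det]; rfl
  have hk : 0 < 1 + L v := by linarith
  have hgm : Measurable (fun y : EE => ENNReal.ofReal ((c + L y) ^ (-σ) * |f y| ^ p)) := by
    fun_prop
  have key := lintegral_affine A (by rw [hdet]; positivity) (c • v)
    (T.indicator (fun y : EE => ENNReal.ofReal ((c + L y) ^ (-σ) * |f y| ^ p)))
    (hgm.indicator hT)
  rw [hdet, lintegral_indicator hT] at key
  have step : ∫⁻ x in R, ENNReal.ofReal ((c + L x) ^ (-σ) * |f (x + (c + L x) • v)| ^ p)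
      ≤ ENNReal.ofReal ((1 + L v) ^ σ) * ∫⁻ x, (T.indicator
        (fun y : EE => ENNReal.ofReal ((c + L y) ^ (-σ) * |f y| ^ p))) (A x + c • v) := by
    rw [← lintegral_const_mul' _ _ (by simp), ← lintegral_indicator hR]
    apply lintegral_mono
    intro x
    by_cases hxR : x ∈ R
    · have e1 : A x + c • v = x + (c + L x) • v := by
        rw [hAdef]; simp [LinearMap.transvection.apply, add_smul]; abel
      simp only [indicator_of_mem hxR, e1, indicator_of_mem (hx x hxR)]
      rw [← ENNReal.ofReal_mul (by positivity)]
      apply ENNReal.ofReal_le_ofReal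
      have hp0 := hRpos x hxR
      have e2 : c + L (x + (c + L x) • v) = (c + L x) * (1 + L v) := by
        simp; ring
      rw [e2, Real.mul_rpow hp0.le hk.le, Real.rpow_neg hk.le]
      have : (1 + L v) ^ σ ≠ 0 := by positivity
      apply le_of_eq
      field_simp
    · simp [indicator_of_notMem hxR]
  refine step.trans ?_
  rw [key, ← mul_assoc, ← ENNReal.ofReal_mul (by positivity)]
  gcongr
  rw [abs_of_pos (by positivity), ← div_eq_mul_inv, ← Real.rpow_sub_one hk.ne']
  apply Real.rpow_le_rpow_of_nonpos <;> linarith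

lemma core (p σ : ℝ) (hp : 1 < p) (hσ0 : 0 < σ) (hσ1 : σ < 1) (T T' R V : Set EE)
    (hT : MeasurableSet T) (hT' : MeasurableSet T')
    (hR : MeasurableSet R) (hV : MeasurableSet V) (M : ℝ) (hM : 0 < M) (hVM : ∀ v ∈ V, ‖v‖ ≤ M)
    (hV0 : volume V ≠ 0) (hVt : volume V ≠ ⊤)
    (hRT : R ⊆ T) (hTT : T' ⊆ T)
    (L : EE →L[ℝ] ℝ) (c : ℝ) (lam : ℝ) (hlam : 0 ≤ lam) (hLv : ∀ v ∈ V, lam ≤ L v)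
    (hRpos : ∀ x ∈ R, 0 < c + L x)
    (hx : ∀ x ∈ R, ∀ v ∈ V, x + (c + L x) • v ∈ T')
    (f : EE → ℝ) (hf : Measurable f) :
    ∫⁻ x in R, ENNReal.ofReal ((c + L x) ^ (-σ) * |f x| ^ p)
      ≤ ENNReal.ofReal (2 ^ p) * ((volume V)⁻¹ * ENNReal.ofReal (M ^ (σ + 2)) *
          (∫⁻ x in T, ∫⁻ y in T, Qk p σ f x y)
        + ENNReal.ofReal ((1 + lam) ^ (σ - 1)) *
          ∫⁻ y in T', ENNReal.ofReal ((c + L y) ^ (-σ) * |f y| ^ p)) := by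
  set I := ∫⁻ x in R, ENNReal.ofReal ((c + L x) ^ (-σ) * |f x| ^ p) with hI
  set J := ∫⁻ y in T', ENNReal.ofReal ((c + L y) ^ (-σ) * |f y| ^ p) with hJ
  set S := ∫⁻ x in T, ∫⁻ y in T, Qk p σ f x y with hS
  set K := ENNReal.ofReal (2 ^ p) with hK
  have hm1 : Measurable (fun z : EE × EE =>
      ENNReal.ofReal ((c + L z.1) ^ (-σ) * |f z.1 - f (z.1 + (c + L z.1) • z.2)| ^ p)) := by
    fun_prop
  have hm2 : Measurable (fun z : EE × EE =>
      ENNReal.ofReal ((c + L z.1) ^ (-σ) * |f (z.1 + (c + L z.1) • z.2)| ^ p)) := by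
    fun_prop
  have h1 : I * volume V ≤ K * ((∫⁻ x in R, ∫⁻ v in V,
      ENNReal.ofReal ((c + L x) ^ (-σ) * |f x - f (x + (c + L x) • v)| ^ p)) +
      ∫⁻ x in R, ∫⁻ v in V,
      ENNReal.ofReal ((c + L x) ^ (-σ) * |f (x + (c + L x) • v)| ^ p)) := by
    rw [hI, ← lintegral_mul_const' _ _ hVt, ← lintegral_add_left (hm1.lintegral_prod_right'),
      ← lintegral_const_mul' _ _ (by simp [hK])]
    apply setLIntegral_mono' hR
    intro x hxR
    have hmx : Measurable (fun v : EE =>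
      ENNReal.ofReal ((c + L x) ^ (-σ) * |f x - f (x + (c + L x) • v)| ^ p)) := by
      fun_prop
    simp only []
    rw [← setLIntegral_const, ← lintegral_add_left hmx, ← lintegral_const_mul' _ _ (by simp [hK])]
    apply lintegral_mono
    intro v
    have h0 := hRpos x hxR
    simp only []
    rw [hK, ← ENNReal.ofReal_add (by positivity) (by positivity),
      ← ENNReal.ofReal_mul (by positivity)]
    apply ENNReal.ofReal_le_ofReal
    have := pow_ineq p hp (f x) (f (x + (c + L x) • v))
    have h3 : 0 ≤ (c + L x) ^ (-σ) := by positivity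
    have := mul_le_mul_of_nonneg_left this h3
    linarith
  have h2 : (∫⁻ x in R, ∫⁻ v in V,
      ENNReal.ofReal ((c + L x) ^ (-σ) * |f x - f (x + (c + L x) • v)| ^ p))
      ≤ ENNReal.ofReal (M ^ (σ + 2)) * S := by
    rw [hS, ← lintegral_const_mul' _ _ (by simp)]
    refine le_trans ?_ (lintegral_mono_set hRT)
    apply setLIntegral_mono' hR
    intro x hxR
    exact first_term p σ hp hσ0 T V hT hV M hM hVM f hf x _ (hRpos x hxR)
      (fun v hv => hTT (hx x hxR v hv))
  have h3 : (∫⁻ x in R, ∫⁻ v in V,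
      ENNReal.ofReal ((c + L x) ^ (-σ) * |f (x + (c + L x) • v)| ^ p))
      ≤ (ENNReal.ofReal ((1 + lam) ^ (σ - 1)) * J) * volume V := by
    rw [lintegral_lintegral_swap hm2.aemeasurable, ← setLIntegral_const]
    apply setLIntegral_mono' hV
    intro v hv
    exact second_term p σ T' R hT' hR L c v lam hlam (hLv v hv) hσ1 hRpos
      (fun x hxR => hx x hxR v hv) f hf
  have h4 : I * volume V ≤ K * (ENNReal.ofReal (M ^ (σ + 2)) * S +
      (ENNReal.ofReal ((1 + lam) ^ (σ - 1)) * J) * volume V) :=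
    h1.trans (by gcongr)
  calc I = (I * volume V) * (volume V)⁻¹ := by
        rw [mul_assoc, ENNReal.mul_inv_cancel hV0 hVt, mul_one]
    _ ≤ (K * (ENNReal.ofReal (M ^ (σ + 2)) * S +
      (ENNReal.ofReal ((1 + lam) ^ (σ - 1)) * J) * volume V)) * (volume V)⁻¹ := by gcongr
    _ = K * ((volume V)⁻¹ * ENNReal.ofReal (M ^ (σ + 2)) * S +
      (ENNReal.ofReal ((1 + lam) ^ (σ - 1)) * J) * (volume V * (volume V)⁻¹)) := by ring
    _ = _ := by rw [ENNReal.mul_inv_cancel hV0 hVt, mul_one]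

/-- Geometric condition on the affine function `c + L`: near the zero set of the affine function,
two regions from which one can move inside `T`. -/
def Geo (T : Set EE) (L : EE →L[ℝ] ℝ) (c : ℝ) : Prop :=
  ∀ N : ℝ, 0 ≤ N → ∃ (δ : ℝ) (R₁ R₂ : Set EE) (v₁ v₂ : EE), 0 < δ ∧
    MeasurableSet R₁ ∧ MeasurableSet R₂ ∧ R₁ ⊆ T ∧ R₂ ⊆ T ∧
    (∀ x ∈ T, x ∈ R₁ ∨ x ∈ R₂ ∨ δ ≤ c + L x) ∧
    (∀ v ∈ Metric.ball v₁ 1, N ≤ L v) ∧ (∀ v ∈ Metric.ball v₂ 1, N ≤ L v) ∧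
    (∀ x ∈ R₁, ∀ v ∈ Metric.ball v₁ 1, x + (c + L x) • v ∈ T) ∧
    (∀ x ∈ R₂, ∀ v ∈ Metric.ball v₂ 1, x + (c + L x) • v ∈ T)

lemma core_ball (p σ : ℝ) (hp : 1 < p) (hσ0 : 0 < σ) (hσ1 : σ < 1) (T R : Set EE) (v₀ : EE)
    (hT : MeasurableSet T) (hR : MeasurableSet R) (hRT : R ⊆ T)
    (L : EE →L[ℝ] ℝ) (c : ℝ) (lam : ℝ) (hlam : 0 ≤ lam)
    (hTpos : ∀ x ∈ T, 0 < c + L x)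
    (hLv : ∀ v ∈ Metric.ball v₀ 1, lam ≤ L v)
    (hx : ∀ x ∈ R, ∀ v ∈ Metric.ball v₀ 1, x + (c + L x) • v ∈ T) :
    ∃ K : ENNReal, K ≠ ⊤ ∧ ∀ (f : EE → ℝ), Measurable f → ∀ ε : ℝ,
    ∫⁻ x in R ∩ {x | ε < c + L x}, ENNReal.ofReal ((c + L x) ^ (-σ) * |f x| ^ p)
      ≤ K * (∫⁻ x in T, ∫⁻ y in T, Qk p σ f x y)
        + ENNReal.ofReal (2 ^ p * (1 + lam) ^ (σ - 1)) *
          ∫⁻ y in T ∩ {x | ε < c + L x}, ENNReal.ofReal ((c + L y) ^ (-σ) * |f y| ^ p) := by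
  have hV0 : volume (Metric.ball v₀ 1) ≠ 0 := (Metric.measure_ball_pos _ _ one_pos).ne'
  have hVt : volume (Metric.ball v₀ 1) ≠ ⊤ := measure_ball_lt_top.ne
  refine ⟨ENNReal.ofReal (2 ^ p) * ((volume (Metric.ball v₀ 1))⁻¹ *
    ENNReal.ofReal ((‖v₀‖ + 1) ^ (σ + 2))), ?_, ?_⟩
  · exact ENNReal.mul_ne_top (by simp) (ENNReal.mul_ne_top (ENNReal.inv_ne_top.mpr hV0) (by simp))
  intro f hf ε
  have hms : MeasurableSet {x : EE | ε < c + L x} :=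
    measurableSet_lt measurable_const (by fun_prop)
  have := core p σ hp hσ0 hσ1 T (T ∩ {x | ε < c + L x}) (R ∩ {x | ε < c + L x})
    (Metric.ball v₀ 1) hT (hT.inter hms) (hR.inter hms) Metric.isOpen_ball.measurableSet
    (‖v₀‖ + 1) (by positivity) (by
      intro v hv
      rw [mem_ball_iff_norm] at hv
      have := norm_le_norm_add_norm_sub v₀ v
      rw [norm_sub_rev] at this
      linarith) hV0 hVt (inter_subset_left.trans hRT) inter_subset_left L c lam hlam hLv
    (fun x hx => hTpos x (hRT hx.1)) (by
      intro x hxR v hv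
      refine ⟨hx x hxR.1 v hv, ?_⟩
      have h1 := hLv v hv
      have h2 := hTpos x (hRT hxR.1)
      have h3 : ε < c + L x := hxR.2
      have e : c + L (x + (c + L x) • v) = (c + L x) + (c + L x) * L v := by simp; ring
      show ε < c + L (x + (c + L x) • v)
      rw [e]
      have : 0 ≤ (c + L x) * L v := mul_nonneg h2.le (hlam.trans h1)
      linarith) f hf
  refine this.trans (le_of_eq ?_)
  rw [ENNReal.ofReal_mul (by positivity)]
  ring

lemma absorb (a b : ENNReal) (ha : a ≠ ⊤) (h : a ≤ b + 2⁻¹ * a) : a ≤ 2 * b := by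
  by_cases hb : b = ⊤
  · simp [hb]
  lift a to NNReal using ha
  lift b to NNReal using hb
  have h2 : ((2⁻¹ : NNReal) : ENNReal) = 2⁻¹ := by simp
  rw [← h2] at h
  norm_cast at h ⊢
  rw [← NNReal.coe_le_coe] at h ⊢
  push_cast at h ⊢
  linarith

lemma exists_lam (p σ : ℝ) (hσ1 : σ < 1) :
    ∃ N : ℝ, 0 ≤ N ∧ 2 ^ p * (1 + N) ^ (σ - 1) ≤ 1 / 4 := by
  have h := tendsto_rpow_neg_atTop (show 0 < 1 - σ by linarith)
  have hpos : (0:ℝ) < 1 / 4 / 2 ^ p := by positivity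
  have h1 := (h.eventually (gt_mem_nhds hpos)).and (Filter.eventually_ge_atTop (1:ℝ))
  obtain ⟨x, hx1, hx2⟩ := h1.exists
  refine ⟨x - 1, by linarith, ?_⟩
  rw [lt_div_iff₀ (by positivity)] at hx1
  rw [show 1 + (x - 1) = x by ring, show σ - 1 = -(1 - σ) by ring]
  linarith

lemma hardy (p σ : ℝ) (hp : 1 < p) (hσ0 : 0 < σ) (hσ1 : σ < 1) (T : Set EE)
    (hT : MeasurableSet T) (L : EE →L[ℝ] ℝ) (c : ℝ)
    (hTpos : ∀ x ∈ T, 0 < c + L x) (hG : Geo T L c) :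
    ∃ K : ENNReal, K ≠ ⊤ ∧ ∀ (f : EE → ℝ), Measurable f →
    ∫⁻ x in T, ENNReal.ofReal ((c + L x) ^ (-σ) * |f x| ^ p)
      ≤ K * ((∫⁻ x in T, ENNReal.ofReal (|f x| ^ p)) +
        ∫⁻ x in T, ∫⁻ y in T, Qk p σ f x y) := by
  obtain ⟨N, hN, hN4⟩ := exists_lam p σ hσ1
  obtain ⟨δ, R₁, R₂, v₁, v₂, hδ, hR₁, hR₂, hRT₁, hRT₂, hcov, hL₁, hL₂, hx₁, hx₂⟩ := hG N hN
  obtain ⟨K₁, hK₁, H₁⟩ := core_ball p σ hp hσ0 hσ1 T R₁ v₁ hT hR₁ hRT₁ L c N hN hTpos hL₁ hx₁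
  obtain ⟨K₂, hK₂, H₂⟩ := core_ball p σ hp hσ0 hσ1 T R₂ v₂ hT hR₂ hRT₂ L c N hN hTpos hL₂ hx₂
  set K₀ := ENNReal.ofReal (δ ^ (-σ)) with hK₀
  refine ⟨2 * (K₀ + K₁ + K₂), ENNReal.mul_ne_top (by simp) (by simp [hK₀, hK₁, hK₂]), ?_⟩
  intro f hf
  set P := ∫⁻ x in T, ENNReal.ofReal (|f x| ^ p) with hP
  set S := ∫⁻ x in T, ∫⁻ y in T, Qk p σ f x y with hS
  set w : EE → ENNReal := fun x => ENNReal.ofReal ((c + L x) ^ (-σ) * |f x| ^ p) with hw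
  have hpt : ∀ ε : ℝ, 0 < ε → ∀ x, ε ≤ c + L x →
      w x ≤ ENNReal.ofReal (ε ^ (-σ)) * ENNReal.ofReal (|f x| ^ p) := by
    intro ε hε x hx
    rw [← ENNReal.ofReal_mul (by positivity)]
    apply ENNReal.ofReal_le_ofReal
    exact mul_le_mul_of_nonneg_right
      (Real.rpow_le_rpow_of_nonpos hε hx (by linarith)) (by positivity)
  by_cases hPt : P = ⊤
  · rw [hPt, top_add, ENNReal.mul_top]
    · exact le_top
    · have : K₀ ≠ 0 := by rw [hK₀]; simp; positivity
      simp [this]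
  have hlev : ∀ ε : ℝ, MeasurableSet {x : EE | ε < c + L x} := fun ε =>
    measurableSet_lt measurable_const (by fun_prop)
  have hlev' : ∀ ε : ℝ, MeasurableSet {x : EE | ε ≤ c + L x} := fun ε =>
    measurableSet_le measurable_const (by fun_prop)
  have main : ∀ ε : ℝ, 0 < ε → ∫⁻ x in T ∩ {x | ε < c + L x}, w x
      ≤ 2 * (K₀ + K₁ + K₂) * (P + S) := by
    intro ε hε
    set Aε := ∫⁻ x in T ∩ {x | ε < c + L x}, w x with hA
    have hfin : Aε ≠ ⊤ := by
      have : Aε ≤ ENNReal.ofReal (ε ^ (-σ)) * P := by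
        rw [hA, hP, ← lintegral_const_mul' _ _ (by simp)]
        refine le_trans (setLIntegral_mono' (hT.inter (hlev ε))
          (fun x hx => hpt ε hε x (le_of_lt hx.2))) (lintegral_mono_set inter_subset_left)
      exact ne_top_of_le_ne_top (ENNReal.mul_ne_top (by simp) hPt) this
    have hsub : T ∩ {x | ε < c + L x} ⊆ (R₁ ∩ {x | ε < c + L x}) ∪
        ((R₂ ∩ {x | ε < c + L x}) ∪ (T ∩ {x | δ ≤ c + L x})) := by
      rintro x ⟨hx, hx'⟩
      rcases hcov x hx with h | h | h
      · exact Or.inl ⟨h, hx'⟩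
      · exact Or.inr (Or.inl ⟨h, hx'⟩)
      · exact Or.inr (Or.inr ⟨hx, h⟩)
    have hle : Aε ≤ (∫⁻ x in R₁ ∩ {x | ε < c + L x}, w x) +
        ((∫⁻ x in R₂ ∩ {x | ε < c + L x}, w x) + ∫⁻ x in T ∩ {x | δ ≤ c + L x}, w x) := by
      refine (lintegral_mono_set hsub).trans ((lintegral_union_le _ _ _).trans ?_)
      gcongr
      exact lintegral_union_le _ _ _
    have h3 : ∫⁻ x in T ∩ {x | δ ≤ c + L x}, w x ≤ K₀ * P := by
      rw [hP, ← lintegral_const_mul' _ _ (by simp [hK₀])]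
      exact le_trans (setLIntegral_mono' (hT.inter (hlev' δ))
          (fun x hx => hpt δ hδ x hx.2)) (lintegral_mono_set inter_subset_left)
    have hq : ENNReal.ofReal (2 ^ p * (1 + N) ^ (σ - 1)) ≤ 4⁻¹ := by
      refine (ENNReal.ofReal_le_ofReal hN4).trans (le_of_eq ?_)
      rw [one_div, ENNReal.ofReal_inv_of_pos (by norm_num)]; simp
    have h1 : ∫⁻ x in R₁ ∩ {x | ε < c + L x}, w x ≤ K₁ * S + 4⁻¹ * Aε :=
      (H₁ f hf ε).trans (by gcongr)
    have h2 : ∫⁻ x in R₂ ∩ {x | ε < c + L x}, w x ≤ K₂ * S + 4⁻¹ * Aε :=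
      (H₂ f hf ε).trans (by gcongr)
    have h24 : (4⁻¹ : ENNReal) + 4⁻¹ = 2⁻¹ := by
      have : (4:ENNReal) = 2 * 2 := by norm_num
      rw [this, ENNReal.mul_inv (by simp) (by simp), ← mul_add, ENNReal.inv_two_add_inv_two,
        mul_one]
    have h4 : Aε ≤ (K₀ * P + K₁ * S + K₂ * S) + 2⁻¹ * Aε := by
      refine hle.trans ((add_le_add h1 (add_le_add h2 h3)).trans (le_of_eq ?_))
      rw [← h24]; ring
    refine (absorb _ _ hfin h4).trans ?_
    rw [mul_assoc]
    gcongr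
    calc K₀ * P + K₁ * S + K₂ * S ≤ K₀ * (P + S) + K₁ * (P + S) + K₂ * (P + S) := by
          gcongr <;> simp
      _ = _ := by ring
  have hU : T = ⋃ n : ℕ, T ∩ {x | 1 / ((n:ℝ) + 1) < c + L x} := by
    ext x
    simp only [mem_iUnion, mem_inter_iff, mem_ofPred_eq]
    constructor
    · intro hx
      obtain ⟨n, hn⟩ := exists_nat_one_div_lt (hTpos x hx)
      exact ⟨n, hx, hn⟩
    · rintro ⟨n, hx, -⟩
      exact hx
  have hmono : Monotone (fun n : ℕ => T ∩ {x : EE | 1 / ((n:ℝ) + 1) < c + L x}) := by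
    intro n m hnm x hx
    refine ⟨hx.1, ?_⟩
    have h2 : 1 / ((n:ℝ) + 1) < c + L x := hx.2
    show 1 / ((m:ℝ) + 1) < c + L x
    refine lt_of_le_of_lt ?_ h2
    exact one_div_le_one_div_of_le (by positivity) (by simpa using hnm)
  rw [hU, setLIntegral_iUnion_of_directed _ hmono.directed_le]
  exact iSup_le (fun n => main _ (by positivity))

lemma coord_ball (v v₀ : EE) (hv : v ∈ Metric.ball v₀ 1) (i : Fin 2) :
    v₀ i - 1 < v i ∧ v i < v₀ i + 1 := by
  rw [mem_ball_iff_norm] at hv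
  have h := (PiLp.norm_apply_le (v - v₀) i).trans_lt hv
  rw [Real.norm_eq_abs, abs_lt] at h
  simp at h
  constructor <;> linarith [h.1, h.2]

noncomputable abbrev pr (i : Fin 2) : EE →L[ℝ] ℝ := EuclideanSpace.proj i

lemma meas_and {P Q : EE → Prop} (h : MeasurableSet {x | P x}) (h' : MeasurableSet {x | Q x}) :
    MeasurableSet {x | P x ∧ Q x} := by
  have e : {x | P x ∧ Q x} = {x | P x} ∩ {x | Q x} := by ext x; simp
  rw [e]; exact h.inter h'

lemma open_and {P Q : EE → Prop} (h : IsOpen {x | P x}) (h' : IsOpen {x | Q x}) :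
    IsOpen {x | P x ∧ Q x} := by
  have e : {x | P x ∧ Q x} = {x | P x} ∩ {x | Q x} := by ext x; simp
  rw [e]; exact h.inter h'

lemma tri_open : IsOpen refTriE := by
  unfold refTriE
  apply open_and
  · exact isOpen_lt continuous_const (by fun_prop)
  apply open_and
  · exact isOpen_lt continuous_const (by fun_prop)
  · exact isOpen_lt (by fun_prop) continuous_const

lemma tri_meas : MeasurableSet refTriE := tri_open.measurableSet

lemma geo0 : Geo refTriE (pr 0) 0 := by
  intro N hN
  have hd : 0 < 1 / (4 * (N + 10)) := by positivity
  have hd2 : 1 / (4 * (N + 10)) * (N + 10) = 1 / 4 := by field_simp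
  generalize 1 / (4 * (N + 10)) = δ at hd hd2
  refine ⟨δ, refTriE ∩ {x | x 0 < δ ∧ x 1 ≤ 1 / 2}, refTriE ∩ {x | x 0 < δ ∧ 1 / 2 < x 1},
    !₂[N + 1, 1], !₂[N + 1, -N - 3], hd, ?_, ?_, inter_subset_left, inter_subset_left,
    ?_, ?_, ?_, ?_, ?_⟩
  · refine tri_meas.inter (meas_and ?_ ?_)
    · exact measurableSet_lt (by fun_prop) measurable_const
    · exact measurableSet_le (by fun_prop) measurable_const
  · refine tri_meas.inter (meas_and ?_ ?_)
    · exact measurableSet_lt (by fun_prop) measurable_const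
    · exact measurableSet_lt measurable_const (by fun_prop)
  · intro x hx
    rcases le_or_gt δ (x 0) with h | h
    · right; right; simpa using h
    rcases le_or_gt (x 1) (1 / 2) with h' | h'
    · exact Or.inl ⟨hx, h, h'⟩
    · exact Or.inr (Or.inl ⟨hx, h, h'⟩)
  · intro v hv
    have h0 := coord_ball _ _ hv 0
    simp at h0 ⊢
    linarith
  · intro v hv
    have h0 := coord_ball _ _ hv 0
    simp at h0 ⊢
    linarith
  · rintro x ⟨⟨hx0, hx1, hx2⟩, h, h'⟩ v hv
    have h0 := coord_ball _ _ hv 0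
    have h1 := coord_ball _ _ hv 1
    simp at h0 h1
    simp only [refTriE, mem_ofPred_eq]
    simp
    refine ⟨?_, ?_, ?_⟩ <;> nlinarith
  · rintro x ⟨⟨hx0, hx1, hx2⟩, h, h'⟩ v hv
    have h0 := coord_ball _ _ hv 0
    have h1 := coord_ball _ _ hv 1
    simp at h0 h1
    simp only [refTriE, mem_ofPred_eq]
    simp
    refine ⟨?_, ?_, ?_⟩ <;> nlinarith

lemma geo1 : Geo refTriE (pr 1) 0 := by
  intro N hN
  have hd : 0 < 1 / (4 * (N + 10)) := by positivity
  have hd2 : 1 / (4 * (N + 10)) * (N + 10) = 1 / 4 := by field_simp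
  generalize 1 / (4 * (N + 10)) = δ at hd hd2
  refine ⟨δ, refTriE ∩ {x | x 1 < δ ∧ x 0 ≤ 1 / 2}, refTriE ∩ {x | x 1 < δ ∧ 1 / 2 < x 0},
    !₂[1, N + 1], !₂[-N - 3, N + 1], hd, ?_, ?_, inter_subset_left, inter_subset_left,
    ?_, ?_, ?_, ?_, ?_⟩
  · refine tri_meas.inter (meas_and ?_ ?_)
    · exact measurableSet_lt (by fun_prop) measurable_const
    · exact measurableSet_le (by fun_prop) measurable_const
  · refine tri_meas.inter (meas_and ?_ ?_)
    · exact measurableSet_lt (by fun_prop) measurable_const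
    · exact measurableSet_lt measurable_const (by fun_prop)
  · intro x hx
    rcases le_or_gt δ (x 1) with h | h
    · right; right; simpa using h
    rcases le_or_gt (x 0) (1 / 2) with h' | h'
    · exact Or.inl ⟨hx, h, h'⟩
    · exact Or.inr (Or.inl ⟨hx, h, h'⟩)
  · intro v hv
    have h0 := coord_ball _ _ hv 1
    simp at h0 ⊢
    linarith
  · intro v hv
    have h0 := coord_ball _ _ hv 1
    simp at h0 ⊢
    linarith
  · rintro x ⟨⟨hx0, hx1, hx2⟩, h, h'⟩ v hv
    have h0 := coord_ball _ _ hv 0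
    have h1 := coord_ball _ _ hv 1
    simp at h0 h1
    simp only [refTriE, mem_ofPred_eq]
    simp
    refine ⟨?_, ?_, ?_⟩ <;> nlinarith
  · rintro x ⟨⟨hx0, hx1, hx2⟩, h, h'⟩ v hv
    have h0 := coord_ball _ _ hv 0
    have h1 := coord_ball _ _ hv 1
    simp at h0 h1
    simp only [refTriE, mem_ofPred_eq]
    simp
    refine ⟨?_, ?_, ?_⟩ <;> nlinarith

lemma geo2 : Geo refTriE (-(pr 0 + pr 1)) 1 := by
  intro N hN
  have hd : 0 < 1 / (4 * (N + 10)) := by positivity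
  have hd2 : 1 / (4 * (N + 10)) * (N + 10) = 1 / 4 := by field_simp
  generalize 1 / (4 * (N + 10)) = δ at hd hd2
  refine ⟨δ, refTriE ∩ {x | 1 - (x 0 + x 1) < δ ∧ x 0 ≤ 1 / 2},
    refTriE ∩ {x | 1 - (x 0 + x 1) < δ ∧ 1 / 2 < x 0},
    !₂[1, -(N + 3)], !₂[-(N + 3), 1], hd, ?_, ?_, inter_subset_left, inter_subset_left,
    ?_, ?_, ?_, ?_, ?_⟩
  · refine tri_meas.inter (meas_and ?_ ?_)
    · exact measurableSet_lt (by fun_prop) measurable_const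
    · exact measurableSet_le (by fun_prop) measurable_const
  · refine tri_meas.inter (meas_and ?_ ?_)
    · exact measurableSet_lt (by fun_prop) measurable_const
    · exact measurableSet_lt measurable_const (by fun_prop)
  · intro x hx
    rcases le_or_gt δ (1 - (x 0 + x 1)) with h | h
    · right; right; simpa [sub_eq_add_neg] using h
    rcases le_or_gt (x 0) (1 / 2) with h' | h'
    · exact Or.inl ⟨hx, h, h'⟩
    · exact Or.inr (Or.inl ⟨hx, h, h'⟩)
  · intro v hv
    have h0 := coord_ball _ _ hv 0
    have h1 := coord_ball _ _ hv 1
    simp at h0 h1 ⊢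
    linarith
  · intro v hv
    have h0 := coord_ball _ _ hv 0
    have h1 := coord_ball _ _ hv 1
    simp at h0 h1 ⊢
    linarith
  · rintro x ⟨⟨hx0, hx1, hx2⟩, h, h'⟩ v hv
    have h0 := coord_ball _ _ hv 0
    have h1 := coord_ball _ _ hv 1
    simp at h0 h1
    have e : 1 + (-(pr 0 + pr 1)) x = 1 - (x 0 + x 1) := by simp; ring
    rw [e]
    have hl : 0 < 1 - (x 0 + x 1) := by linarith
    obtain ⟨l, hlx⟩ : ∃ l, l = 1 - (x 0 + x 1) := ⟨_, rfl⟩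
    simp only [refTriE, mem_ofPred_eq]
    rw [← hlx] at h hl ⊢
    simp
    refine ⟨?_, ?_, ?_⟩ <;> nlinarith
  · rintro x ⟨⟨hx0, hx1, hx2⟩, h, h'⟩ v hv
    have h0 := coord_ball _ _ hv 0
    have h1 := coord_ball _ _ hv 1
    simp at h0 h1
    have e : 1 + (-(pr 0 + pr 1)) x = 1 - (x 0 + x 1) := by simp; ring
    rw [e]
    have hl : 0 < 1 - (x 0 + x 1) := by linarith
    obtain ⟨l, hlx⟩ : ∃ l, l = 1 - (x 0 + x 1) := ⟨_, rfl⟩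
    simp only [refTriE, mem_ofPred_eq]
    rw [← hlx] at h hl ⊢
    simp
    refine ⟨?_, ?_, ?_⟩ <;> nlinarith

/-- A frontier point lies on one of the three sides. -/
lemma frontier_side (y : EE) (hy : y ∈ frontier refTriE) :
    y 0 ≤ 0 ∨ y 1 ≤ 0 ∨ 1 ≤ y 0 + y 1 := by
  rw [tri_open.frontier_eq] at hy
  by_contra hcon
  push Not at hcon
  exact hy.2 ⟨hcon.1, hcon.2.1, hcon.2.2⟩

lemma dist_weight (σ : ℝ) (hσ0 : 0 < σ) (hσ1 : σ < 1) (x : EE) (hx : x ∈ refTriE) :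
    Metric.infDist x (frontier refTriE) ^ (-σ) ≤
      (0 + pr 0 x) ^ (-σ) + (0 + pr 1 x) ^ (-σ) +
        2 * (1 + (-(pr 0 + pr 1)) x) ^ (-σ) := by
  obtain ⟨hx0, hx1, hx2⟩ := hx
  have e : 1 + (-(pr 0 + pr 1)) x = 1 - (x 0 + x 1) := by simp; ring
  have e0 : 0 + pr 0 x = x 0 := by simp
  have e1 : 0 + pr 1 x = x 1 := by simp
  rw [e, e0, e1]
  have hl : 0 < 1 - (x 0 + x 1) := by linarith
  have p0 : 0 < (x 0) ^ (-σ) := by positivity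
  have p1 : 0 < (x 1) ^ (-σ) := by positivity
  have p2 : 0 < (1 - (x 0 + x 1)) ^ (-σ) := by positivity
  rcases (frontier refTriE).eq_empty_or_nonempty with hE | hne
  · rw [hE, Metric.infDist_empty, Real.zero_rpow (by linarith)]
    linarith
  have hm : min (x 0) (min (x 1) ((1 - (x 0 + x 1)) / 2)) ≤
      Metric.infDist x (frontier refTriE) := by
    rw [Metric.le_infDist hne]
    intro y hy
    have a0 := (PiLp.norm_apply_le (x - y) 0)
    have a1 := (PiLp.norm_apply_le (x - y) 1)
    rw [Real.norm_eq_abs, abs_le] at a0 a1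
    simp at a0 a1
    rw [dist_eq_norm]
    rcases frontier_side y hy with h | h | h
    · exact (min_le_left _ _).trans (by linarith)
    · exact (min_le_right _ _).trans ((min_le_left _ _).trans (by linarith))
    · exact (min_le_right _ _).trans ((min_le_right _ _).trans (by linarith))
  have h2 : ((1 - (x 0 + x 1)) / 2) ^ (-σ) ≤ 2 * (1 - (x 0 + x 1)) ^ (-σ) := by
    rw [Real.div_rpow hl.le (by norm_num), Real.rpow_neg (by norm_num : (0:ℝ) ≤ 2),
      div_inv_eq_mul, mul_comm]
    gcongr
    calc (2:ℝ) ^ σ ≤ 2 ^ (1:ℝ) := Real.rpow_le_rpow_of_exponent_le (by norm_num) hσ1.le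
      _ = 2 := by simp
  have hmono : ∀ a : ℝ, 0 < a → a ≤ Metric.infDist x (frontier refTriE) →
      Metric.infDist x (frontier refTriE) ^ (-σ) ≤ a ^ (-σ) := fun a ha hle =>
    Real.rpow_le_rpow_of_nonpos ha hle (by linarith)
  rcases min_le_iff.mp hm with h | h
  · have := hmono _ hx0 h; linarith
  rcases min_le_iff.mp h with h | h
  · have := hmono _ hx1 h; linarith
  · have := hmono _ (by linarith) h; linarith

/-- Grisvard's weighted estimate for `sp < 1` on the reference triangle: for
every `f ∈ W^{s,p}(T)` (no boundary condition required),
`∫_T dist(x,∂T)^{-sp} |f|^p ≲_{s,p} ‖f‖_{W^{s,p}(T)}^p`. -/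
theorem stmt14 (p s : ℝ) (hp : 1 < p) (hs0 : 0 < s) (hs1 : s < 1) (hsp : s * p < 1) :
    ∃ C : ℝ, 0 < C ∧ ∀ f : EuclideanSpace ℝ (Fin 2) → ℝ, Measurable f →
      ∫⁻ x in refTriE,
          ENNReal.ofReal (Metric.infDist x (frontier refTriE) ^ (-(s * p)) * |f x| ^ p)
        ≤ ENNReal.ofReal C *
          ((∫⁻ x in refTriE, ENNReal.ofReal (|f x| ^ p)) +
            ∫⁻ x in refTriE, ∫⁻ y in refTriE,
              ENNReal.ofReal (|f x - f y| ^ p / ‖x - y‖ ^ (s * p + 2))) := by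
  have hσ0 : 0 < s * p := by positivity
  set σ := s * p with hσ
  have q0 : ∀ x ∈ refTriE, 0 < 0 + pr 0 x := by
    rintro x ⟨h0, h1, h2⟩; simpa using h0
  have q1 : ∀ x ∈ refTriE, 0 < 0 + pr 1 x := by
    rintro x ⟨h0, h1, h2⟩; simpa using h1
  have q2 : ∀ x ∈ refTriE, 0 < 1 + (-(pr 0 + pr 1)) x := by
    rintro x ⟨h0, h1, h2⟩
    have e : 1 + (-(pr 0 + pr 1)) x = 1 - (x 0 + x 1) := by simp; ring
    rw [e]; linarith
  obtain ⟨K₀, hK₀, H₀⟩ := hardy p σ hp hσ0 hsp refTriE tri_meas (pr 0) 0 q0 geo0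
  obtain ⟨K₁, hK₁, H₁⟩ := hardy p σ hp hσ0 hsp refTriE tri_meas (pr 1) 0 q1 geo1
  obtain ⟨K₂, hK₂, H₂⟩ := hardy p σ hp hσ0 hsp refTriE tri_meas (-(pr 0 + pr 1)) 1 q2 geo2
  have hKt : K₀ + K₁ + 2 * K₂ ≠ ⊤ := by
    simp [hK₀, hK₁, ENNReal.mul_eq_top, hK₂]
  refine ⟨(K₀ + K₁ + 2 * K₂).toReal + 1, by positivity, ?_⟩
  intro f hf
  have hC : K₀ + K₁ + 2 * K₂ ≤ ENNReal.ofReal ((K₀ + K₁ + 2 * K₂).toReal + 1) := by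
    rw [ENNReal.le_ofReal_iff_toReal_le hKt (by positivity)]
    linarith
  have h0 := H₀ f hf
  have h1 := H₁ f hf
  have h2 := H₂ f hf
  change _ ≤ _ * (_ + ∫⁻ x in refTriE, ∫⁻ y in refTriE, Qk p σ f x y)
  refine le_trans ?_ (mul_le_mul_left hC _)
  have hm0 : Measurable (fun x : EE => ENNReal.ofReal ((0 + pr 0 x) ^ (-σ) * |f x| ^ p)) := by
    fun_prop
  have hm1 : Measurable (fun x : EE => ENNReal.ofReal ((0 + pr 1 x) ^ (-σ) * |f x| ^ p)) := by
    fun_prop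
  have hm01 : Measurable (fun x : EE => ENNReal.ofReal ((0 + pr 0 x) ^ (-σ) * |f x| ^ p) +
      ENNReal.ofReal ((0 + pr 1 x) ^ (-σ) * |f x| ^ p)) := hm0.add hm1
  have hpt : ∫⁻ x in refTriE,
      ENNReal.ofReal (Metric.infDist x (frontier refTriE) ^ (-σ) * |f x| ^ p) ≤
      (∫⁻ x in refTriE, ENNReal.ofReal ((0 + pr 0 x) ^ (-σ) * |f x| ^ p)) +
      (∫⁻ x in refTriE, ENNReal.ofReal ((0 + pr 1 x) ^ (-σ) * |f x| ^ p)) +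
      2 * ∫⁻ x in refTriE,
        ENNReal.ofReal ((1 + (-(pr 0 + pr 1)) x) ^ (-σ) * |f x| ^ p) := by
    rw [← lintegral_const_mul' _ _ (by simp), ← lintegral_add_left hm0,
      ← lintegral_add_left hm01]
    apply setLIntegral_mono' tri_meas
    intro x hx
    have a0 := q0 x hx
    have a1 := q1 x hx
    have a2 := q2 x hx
    have hd := dist_weight σ hσ0 hsp x hx
    have e2 : ∀ t : ℝ, (2 : ENNReal) * ENNReal.ofReal t = ENNReal.ofReal (2 * t) := by
      intro t
      rw [ENNReal.ofReal_mul (by norm_num)]; simp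
    rw [e2, ← ENNReal.ofReal_add (by positivity) (by positivity),
      ← ENNReal.ofReal_add (by positivity) (by positivity)]
    apply ENNReal.ofReal_le_ofReal
    have h3 : 0 ≤ |f x| ^ p := by positivity
    have := mul_le_mul_of_nonneg_right hd h3
    linarith
  refine hpt.trans ((add_le_add (add_le_add h0 h1) (mul_le_mul_right h2 2)).trans (le_of_eq ?_))
  ring
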